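/- Let V be a finite vertex type, G a connected simple graph on V, and s, t : E(G) → V an orientation of G, i.e., functions such that every edge e of G equals the unordered pair {s(e), t(e)}. Define the integral boundary map ∂ℤ : (E(G) → ℤ) →ₗ (V → ℤ) by (∂ℤ f)(v) = Σ_{e : t(e) = v} f(e) − Σ_{e : s(e) = v} f(e). Then the kernel of ∂ℤ is a free ℤ-module of rank |E(G)| − |V| + 1. -/

import Mathlib

open Finset in
/-- The integral boundary map associated to an orientation `s, t` of the edges of `G`:
`(∂ℤ f) v = ∑_{e : t e = v} f e − ∑_{e : s e = v} f e`. -/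
def boundaryInt (V : Type*) [Fintype V] [DecidableEq V]
    (G : SimpleGraph V) [DecidableRel G.Adj] (s t : G.edgeSet → V) :
    (G.edgeSet → ℤ) →ₗ[ℤ] (V → ℤ) where
  toFun f v := (∑ e : G.edgeSet, if t e = v then f e else 0)
    - (∑ e : G.edgeSet, if s e = v then f e else 0)
  map_add' f g := by
    funext v
    simp only [Pi.add_apply]
    have hA : (∑ e : G.edgeSet, if t e = v then f e + g e else 0)
        = (∑ e : G.edgeSet, if t e = v then f e else 0)
          + (∑ e : G.edgeSet, if t e = v then g e else 0) := by
      rw [← Finset.sum_add_distrib]; congr 1; funext e; split <;> simp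
    have hB : (∑ e : G.edgeSet, if s e = v then f e + g e else 0)
        = (∑ e : G.edgeSet, if s e = v then f e else 0)
          + (∑ e : G.edgeSet, if s e = v then g e else 0) := by
      rw [← Finset.sum_add_distrib]; congr 1; funext e; split <;> simp
    rw [hA, hB]; ring
  map_smul' a f := by
    funext v
    simp only [Pi.smul_apply, smul_eq_mul, RingHom.id_apply]
    have hA : (∑ e : G.edgeSet, if t e = v then a * f e else 0)
        = a * (∑ e : G.edgeSet, if t e = v then f e else 0) := by
      rw [Finset.mul_sum]; congr 1; funext e; split <;> simp
    have hB : (∑ e : G.edgeSet, if s e = v then a * f e else 0)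
        = a * (∑ e : G.edgeSet, if s e = v then f e else 0) := by
      rw [Finset.mul_sum]; congr 1; funext e; split <;> simp
    rw [hA, hB]; ring

section Boundary

variable {V : Type*} [Fintype V] [DecidableEq V] {G : SimpleGraph V} [DecidableRel G.Adj]
  {s t : G.edgeSet → V}

/-- The boundary of an edge is its target minus its source. -/
theorem boundaryInt_single (e : G.edgeSet) :
    boundaryInt V G s t (Pi.single e 1) = Pi.single (t e) 1 - Pi.single (s e) 1 := by
  funext v
  have h (u : G.edgeSet → V) :
      (∑ e' : G.edgeSet, if u e' = v then (Pi.single e 1 : G.edgeSet → ℤ) e' else 0)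
        = (Pi.single (u e) 1 : V → ℤ) v := by
    rw [Finset.sum_eq_single e]
    · simp [Pi.single_apply, eq_comm]
    · intro b _ hb
      simp [hb]
    · simp
  change (∑ e' : G.edgeSet, if t e' = v then (Pi.single e 1 : G.edgeSet → ℤ) e' else 0)
    - (∑ e' : G.edgeSet, if s e' = v then (Pi.single e 1 : G.edgeSet → ℤ) e' else 0) = _
  rw [h, h, Pi.sub_apply]

theorem sum_boundaryInt (f : G.edgeSet → ℤ) : ∑ v, boundaryInt V G s t f v = 0 := by
  change ∑ v, ((∑ e : G.edgeSet, if t e = v then f e else 0)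
    - (∑ e : G.edgeSet, if s e = v then f e else 0)) = 0
  rw [Finset.sum_sub_distrib, Finset.sum_comm, sub_eq_zero]
  conv_rhs => rw [Finset.sum_comm]
  simp

theorem single_sub_single_mem_range_boundaryInt
    (hor : ∀ e : G.edgeSet, (e : Sym2 V) = s(s e, t e)) {u v : V} (h : G.Reachable u v) :
    (Pi.single v 1 - Pi.single u 1 : V → ℤ) ∈ LinearMap.range (boundaryInt V G s t) := by
  obtain ⟨p⟩ := h
  induction p with
  | nil => simp
  | @cons a b c hab _ ih =>
    have hstep : (Pi.single b 1 - Pi.single a 1 : V → ℤ)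
        ∈ LinearMap.range (boundaryInt V G s t) := by
      have he := hor ⟨s(a, b), hab⟩
      have hmem := LinearMap.mem_range_self (boundaryInt V G s t)
        (Pi.single ⟨s(a, b), hab⟩ 1)
      rw [boundaryInt_single] at hmem
      rcases Sym2.eq_iff.mp he with ⟨h₁, h₂⟩ | ⟨h₁, h₂⟩
      · rwa [← h₁, ← h₂] at hmem
      · rw [← h₁, ← h₂] at hmem
        simpa using neg_mem hmem
    simpa using add_mem ih hstep

/-- For a connected graph, the boundaries are exactly the `0`-chains of total weight zero. -/
theorem range_boundaryInt (hG : G.Connected)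
    (hor : ∀ e : G.edgeSet, (e : Sym2 V) = s(s e, t e)) :
    LinearMap.range (boundaryInt V G s t)
      = LinearMap.ker (∑ v, LinearMap.proj v : (V → ℤ) →ₗ[ℤ] ℤ) := by
  apply le_antisymm
  · rintro _ ⟨f, rfl⟩
    simpa using sum_boundaryInt f
  · intro g hg
    have hg : ∑ v, g v = 0 := by simpa using hg
    obtain ⟨v₀⟩ := hG.nonempty
    have hdecomp : g = ∑ v, g v • (Pi.single v 1 - Pi.single v₀ 1 : V → ℤ) := by
      simp only [smul_sub, Finset.sum_sub_distrib, ← Finset.sum_smul, hg, zero_smul, sub_zero]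
      exact pi_eq_sum_univ' g
    rw [hdecomp]
    exact sum_mem fun v _ => Submodule.smul_mem _ _
      (single_sub_single_mem_range_boundaryInt hor (hG.preconnected v₀ v))

end Boundary

/-- Rank-nullity for finite modules over a domain. -/
theorem finrank_range_add_finrank_ker_of_isDomain {R M N : Type*} [CommRing R] [IsDomain R]
    [AddCommGroup M] [Module R M] [Module.Finite R M] [AddCommGroup N] [Module R N]
    (f : M →ₗ[R] N) :
    Module.finrank R (LinearMap.range f) + Module.finrank R (LinearMap.ker f)
      = Module.finrank R M := by
  rw [← f.quotKerEquivRange.finrank_eq, Submodule.finrank_quotient_add_finrank]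

/-- The functions of total sum zero on a nonempty finite type have corank one. -/
theorem finrank_ker_sum_proj_add_one (V : Type*) [Fintype V] [Nonempty V] :
    Module.finrank ℤ (LinearMap.ker (∑ v, LinearMap.proj v : (V → ℤ) →ₗ[ℤ] ℤ)) + 1
      = Fintype.card V := by
  classical
  have hsurj : LinearMap.range (∑ v, LinearMap.proj v : (V → ℤ) →ₗ[ℤ] ℤ) = ⊤ := by
    refine LinearMap.range_eq_top.mpr fun n => ?_
    exact ⟨Pi.single (Classical.arbitrary V) n, by simp⟩
  have h := finrank_range_add_finrank_ker_of_isDomain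
    (∑ v, LinearMap.proj v : (V → ℤ) →ₗ[ℤ] ℤ)
  rw [hsurj, finrank_top, Module.finrank_self, Module.finrank_fintype_fun_eq_card] at h
  omega

/-- For a connected simple graph `G` on a finite vertex type with an orientation
`s, t` of its edges, the kernel of the integral boundary map is a free `ℤ`-module of rank
`|E(G)| - |V| + 1`. -/
theorem stmt_10 {V : Type*} [Fintype V] [DecidableEq V]
    (G : SimpleGraph V) [DecidableRel G.Adj] (hG : G.Connected)
    (s t : G.edgeSet → V) (hor : ∀ e : G.edgeSet, (e : Sym2 V) = s(s e, t e)) :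
    Module.Free ℤ ↥(LinearMap.ker (boundaryInt V G s t)) ∧
      (Module.finrank ℤ ↥(LinearMap.ker (boundaryInt V G s t)) : ℤ) =
        (Fintype.card G.edgeSet : ℤ) - (Fintype.card V : ℤ) + 1 := by
  refine ⟨inferInstance, ?_⟩
  have := hG.nonempty
  have hE := finrank_range_add_finrank_ker_of_isDomain (boundaryInt V G s t)
  have hV := finrank_ker_sum_proj_add_one V
  rw [range_boundaryInt hG hor, Module.finrank_fintype_fun_eq_card] at hE
  omega
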